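/- arXiv:1101.3492 — 2 statements merged into one kernel-verified Lean document; each statement's English description precedes it below -/
import Mathlib

section
/- The retarded and advanced solution-space isomorphisms differ by the operator −Δ ∘ P ∘ Δ_⋆: for every φ ∈ A[[λ]], T_+(Δ_⋆(φ)) − T_−(Δ_⋆(φ)) = −Δ(P(Δ_⋆(φ))), where T_± := id_{B[[λ]]} + Δ_± ∘ Σ_{n≥1} λⁿ P_(n) and where P ∘ Δ_⋆ indeed takes values in A[[λ]] because P ∘ Δ_⋆ = −(Σ_{n≥1} λⁿ P_(n)) ∘ Δ_⋆. -/
open Finset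

noncomputable section

namespace NCQFT

/-- The `ℝ[[λ]]`-linear map `V[[λ]] → W[[λ]]` induced by a family `F_(n)` of `ℝ`-linear maps,
`F_⋆ = Σ λⁿ F_(n)`, i.e. `(F_⋆ u)_(n) = Σ_{m+k=n} F_(m)(u_(k))`. -/
def starFun {V W : Type*} [AddCommGroup V] [Module ℝ V] [AddCommGroup W] [Module ℝ W]
    (F : ℕ → V →ₗ[ℝ] W) (u : ℕ → V) : ℕ → W :=
  fun n => ∑ p ∈ antidiagonal n, F p.1 (u p.2)

variable {B : Type*} [AddCommGroup B] [Module ℝ B]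

/-- `chain D Pn [j₁, …, j_k] = D ∘ P_(j₁) ∘ D ∘ P_(j₂) ∘ ⋯ ∘ D ∘ P_(j_k) ∘ D`. -/
def chain (D : B →ₗ[ℝ] B) (Pn : ℕ → B →ₗ[ℝ] B) : List ℕ → (B →ₗ[ℝ] B)
  | [] => D
  | j :: t => D ∘ₗ Pn j ∘ₗ chain D Pn t

/-- The `n`-th coefficient `Δ_(n)±` of the deformed Green's operator:
`Δ_(n)± = Σ_{k=1}^{n} Σ_{j₁+⋯+j_k = n, jᵢ ≥ 1} (−1)^k Δ_± ∘ P_(j₁) ∘ Δ_± ∘ P_(j₂) ∘ ⋯ ∘ Δ_± ∘ P_(j_k) ∘ Δ_±`,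
realized as a sum over all compositions `(j₁, …, j_k)` of `n` (for `n = 0` it equals `Δ_±`). -/
def dGreen (D : B →ₗ[ℝ] B) (Pn : ℕ → B →ₗ[ℝ] B) (n : ℕ) : B →ₗ[ℝ] B :=
  ∑ c : Composition n, ((-1 : ℝ) ^ c.blocks.length) • chain D Pn c.blocks

end NCQFT

namespace NCQFT

/-- The family `Q_(n)` of `Q := Σ_{n ≥ 1} λⁿ P_(n)` (the `λ⁰`-coefficient is dropped). -/
def posPart {B : Type*} [AddCommGroup B] [Module ℝ B] (Pn : ℕ → B →ₗ[ℝ] B) :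
    ℕ → B →ₗ[ℝ] B :=
  fun n => if n = 0 then 0 else Pn n

/-- The deformed retarded-advanced Green's operator `Δ_⋆ = Δ_⋆₊ − Δ_⋆₋` applied to `φ`. -/
def dstarFun {B : Type*} [AddCommGroup B] [Module ℝ B]
    (Dp Dm : B →ₗ[ℝ] B) (Pn : ℕ → B →ₗ[ℝ] B) (φ : ℕ → B) : ℕ → B :=
  starFun (dGreen Dp Pn) φ - starFun (dGreen Dm Pn) φ

/-- `T_± := id_{B[[λ]]} + Δ_± ∘ Q`, with `Δ_±` acting coefficientwise and
`Q = Σ_{n ≥ 1} λⁿ P_(n)`. -/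
def tMap {B : Type*} [AddCommGroup B] [Module ℝ B]
    (D : B →ₗ[ℝ] B) (Pn : ℕ → B →ₗ[ℝ] B) (u : ℕ → B) : ℕ → B :=
  u + fun n => D (starFun (posPart Pn) u n)

def blockSet (n : ℕ) : Finset (List ℕ) :=
  (Finset.univ : Finset (Composition n)).image Composition.blocks

theorem mem_blockSet (n : ℕ) (l : List ℕ) :
    l ∈ blockSet n ↔ (∀ i ∈ l, 0 < i) ∧ l.sum = n := by
  simp only [blockSet, Finset.mem_image, Finset.mem_univ, true_and]
  constructor
  · rintro ⟨c, rfl⟩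
    exact ⟨fun i hi => c.blocks_pos hi, c.blocks_sum⟩
  · rintro ⟨h1, h2⟩
    exact ⟨⟨l, fun {i} hi => h1 i hi, h2⟩, rfl⟩

theorem dGreen_eq {B : Type*} [AddCommGroup B] [Module ℝ B]
    (D : B →ₗ[ℝ] B) (Pn : ℕ → B →ₗ[ℝ] B) (n : ℕ) :
    dGreen D Pn n = ∑ l ∈ blockSet n, ((-1 : ℝ) ^ l.length) • chain D Pn l := by
  rw [blockSet, Finset.sum_image]
  · rfl
  · intro a _ b _ h
    exact Composition.ext h

theorem dGreen_zero {B : Type*} [AddCommGroup B] [Module ℝ B]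
    (D : B →ₗ[ℝ] B) (Pn : ℕ → B →ₗ[ℝ] B) : dGreen D Pn 0 = D := by
  have h : blockSet 0 = {[]} := by
    ext l
    rw [mem_blockSet, Finset.mem_singleton]
    cases l with
    | nil => simp
    | cons a t => simp; omega
  rw [dGreen_eq, h]
  simp [chain]

theorem dGreen_rec {B : Type*} [AddCommGroup B] [Module ℝ B]
    (D : B →ₗ[ℝ] B) (Pn : ℕ → B →ₗ[ℝ] B) (n : ℕ) (hn : n ≠ 0) :
    dGreen D Pn n =
      - ∑ p ∈ antidiagonal n, D ∘ₗ posPart Pn p.1 ∘ₗ dGreen D Pn p.2 := by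
  have h1 : ∑ p ∈ antidiagonal n, D ∘ₗ posPart Pn p.1 ∘ₗ dGreen D Pn p.2 =
      ∑ p ∈ (antidiagonal n).filter (fun p => p.1 ≠ 0),
        ∑ l ∈ blockSet p.2, D ∘ₗ Pn p.1 ∘ₗ (((-1 : ℝ) ^ l.length) • chain D Pn l) := by
    rw [Finset.sum_filter]
    refine Finset.sum_congr rfl fun p _ => ?_
    by_cases hp : p.1 = 0
    · simp [posPart, hp]
    · simp only [posPart, hp, if_false, ne_eq, not_false_eq_true, if_true]
      rw [dGreen_eq]
      ext x
      simp
  rw [h1, Finset.sum_sigma', dGreen_eq, ← Finset.sum_neg_distrib]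
  symm
  refine Finset.sum_bij (fun q _ => q.1.1 :: q.2) ?_ ?_ ?_ ?_
  · rintro ⟨⟨a, b⟩, l⟩ h
    simp only [Finset.mem_sigma, Finset.mem_filter, HasAntidiagonal.mem_antidiagonal, mem_blockSet] at h ⊢
    obtain ⟨⟨h1, h2⟩, h3, h4⟩ := h
    simp only [List.mem_cons, List.sum_cons]
    refine ⟨?_, by omega⟩
    rintro i (rfl | hi)
    · omega
    · exact h3 i hi
  · rintro ⟨⟨a, b⟩, l⟩ h ⟨⟨a', b'⟩, l'⟩ h' e
    simp only [Finset.mem_sigma, Finset.mem_filter, HasAntidiagonal.mem_antidiagonal, mem_blockSet] at h h'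
    simp only [List.cons.injEq] at e
    obtain ⟨rfl, rfl⟩ := e
    have : b = b' := by omega
    subst this
    rfl
  · intro l hl
    rw [mem_blockSet] at hl
    cases l with
    | nil => simp at hl; omega
    | cons a t =>
      refine ⟨⟨(a, t.sum), t⟩, ?_, rfl⟩
      simp only [List.mem_cons, List.sum_cons] at hl
      simp only [Finset.mem_sigma, Finset.mem_filter, HasAntidiagonal.mem_antidiagonal, mem_blockSet]
      have := hl.1 a (Or.inl rfl)
      exact ⟨⟨hl.2, by omega⟩, fun i hi => hl.1 i (Or.inr hi), by trivial⟩
  · rintro ⟨⟨a, b⟩, l⟩ h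
    ext x
    simp [chain, pow_succ]

theorem dGreen_all {B : Type*} [AddCommGroup B] [Module ℝ B]
    (D : B →ₗ[ℝ] B) (Pn : ℕ → B →ₗ[ℝ] B) (n : ℕ) (x : B) :
    dGreen D Pn n x = (if n = 0 then D x else 0)
      - ∑ p ∈ antidiagonal n, D (posPart Pn p.1 (dGreen D Pn p.2 x)) := by
  by_cases hn : n = 0
  · subst hn
    simp [dGreen_zero, posPart]
  · rw [dGreen_rec D Pn n hn]
    simp [hn]

theorem starFun_dGreen {B : Type*} [AddCommGroup B] [Module ℝ B]
    (D : B →ₗ[ℝ] B) (Pn : ℕ → B →ₗ[ℝ] B) (φ : ℕ → B) (n : ℕ) :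
    starFun (dGreen D Pn) φ n =
      D (φ n) - D (starFun (posPart Pn) (starFun (dGreen D Pn) φ) n) := by
  have h : starFun (dGreen D Pn) φ n = ∑ p ∈ antidiagonal n,
      ((if p.1 = 0 then D (φ p.2) else 0)
        - ∑ q ∈ antidiagonal p.1, D (posPart Pn q.1 (dGreen D Pn q.2 (φ p.2)))) :=
    Finset.sum_congr rfl fun p _ => dGreen_all D Pn p.1 (φ p.2)
  rw [h, Finset.sum_sub_distrib]
  congr 1
  · rw [Finset.sum_eq_single (0, n)]
    · simp
    · rintro ⟨a, b⟩ hab hne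
      rw [HasAntidiagonal.mem_antidiagonal] at hab
      have : a ≠ 0 := by
        rintro rfl
        apply hne
        simp at hab
        simp [hab]
      simp [this]
    · intro h
      simp at h
  · simp only [starFun, map_sum]
    rw [Finset.sum_sigma', Finset.sum_sigma']
    refine Finset.sum_nbij' (fun x => ⟨(x.2.1, x.2.2 + x.1.2), (x.2.2, x.1.2)⟩)
      (fun x => ⟨(x.1.1 + x.2.1, x.2.2), (x.1.1, x.2.1)⟩) ?_ ?_ ?_ ?_ ?_
    · rintro ⟨⟨a, b⟩, ⟨c, d⟩⟩ h
      simp at h ⊢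
      omega
    · rintro ⟨⟨a, b⟩, ⟨c, d⟩⟩ h
      simp at h ⊢
      omega
    · rintro ⟨⟨a, b⟩, ⟨c, d⟩⟩ h
      simp at h ⊢
      omega
    · rintro ⟨⟨a, b⟩, ⟨c, d⟩⟩ h
      simp at h ⊢
      omega
    · rintro ⟨⟨a, b⟩, ⟨c, d⟩⟩ h
      rfl

theorem starFun_posPart_mem {B : Type*} [AddCommGroup B] [Module ℝ B] (A : Submodule ℝ B)
    (Pn : ℕ → B →ₗ[ℝ] B) (hPpos : ∀ n, 0 < n → ∀ u : B, Pn n u ∈ A) (u : ℕ → B) (n : ℕ) :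
    starFun (posPart Pn) u n ∈ A := by
  refine A.sum_mem fun p _ => ?_
  by_cases hp : p.1 = 0
  · simp [posPart, hp]
  · simp only [posPart, hp, if_false]
    exact hPpos _ (Nat.pos_of_ne_zero hp) _

theorem P_starFun_dGreen {B : Type*} [AddCommGroup B] [Module ℝ B] (A : Submodule ℝ B)
    (Pn : ℕ → B →ₗ[ℝ] B) (hPpos : ∀ n, 0 < n → ∀ u : B, Pn n u ∈ A)
    (D : B →ₗ[ℝ] B) (hPD : ∀ a ∈ A, Pn 0 (D a) = a)
    (φ : ℕ → B) (hφ : ∀ n, φ n ∈ A) (n : ℕ) :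
    Pn 0 (starFun (dGreen D Pn) φ n) =
      φ n - starFun (posPart Pn) (starFun (dGreen D Pn) φ) n := by
  rw [starFun_dGreen, map_sub, hPD _ (hφ n), hPD _ (starFun_posPart_mem A Pn hPpos _ n)]

/-- the retarded and advanced solution-space isomorphisms differ by the operator
`−Δ ∘ P ∘ Δ_⋆`: for every `φ ∈ A[[λ]]`, `T₊(Δ_⋆(φ)) − T₋(Δ_⋆(φ)) = −Δ(P(Δ_⋆(φ)))`, where
`P ∘ Δ_⋆` indeed takes values in `A[[λ]]` because `P ∘ Δ_⋆ = −(Σ_{n≥1} λⁿ P_(n)) ∘ Δ_⋆`. -/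
theorem statement_11
    {B : Type*} [AddCommGroup B] [Module ℝ B] (A : Submodule ℝ B)
    -- the family `P_(n)` (`P := P_(0)`), with `P(A) ⊆ A` and `P_(n) : B → A` for `n ≥ 1`
    (Pn : ℕ → B →ₗ[ℝ] B)
    (hPA : ∀ a ∈ A, Pn 0 a ∈ A)
    (hPpos : ∀ n, 0 < n → ∀ u : B, Pn n u ∈ A)
    -- the undeformed retarded/advanced Green's operators `Δ_±` (defined on `A`)
    (Dp Dm : B →ₗ[ℝ] B)
    (hPDp : ∀ a ∈ A, Pn 0 (Dp a) = a) (hDpP : ∀ a ∈ A, Dp (Pn 0 a) = a)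
    (hPDm : ∀ a ∈ A, Pn 0 (Dm a) = a) (hDmP : ∀ a ∈ A, Dm (Pn 0 a) = a)
    (φ : ℕ → B) (hφ : ∀ n, φ n ∈ A) :
    -- `P ∘ Δ_⋆ = −(Σ_{n≥1} λⁿ P_(n)) ∘ Δ_⋆` on `φ`, hence `P(Δ_⋆(φ)) ∈ A[[λ]]`
    (fun n => Pn 0 (dstarFun Dp Dm Pn φ n)) = -(starFun (posPart Pn) (dstarFun Dp Dm Pn φ)) ∧
    (∀ n, Pn 0 (dstarFun Dp Dm Pn φ n) ∈ A) ∧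
    -- `T₊(Δ_⋆(φ)) − T₋(Δ_⋆(φ)) = −Δ(P(Δ_⋆(φ)))`, with `Δ = Δ₊ − Δ₋` acting coefficientwise
    tMap Dp Pn (dstarFun Dp Dm Pn φ) - tMap Dm Pn (dstarFun Dp Dm Pn φ)
      = fun n => -((Dp - Dm) (Pn 0 (dstarFun Dp Dm Pn φ n))) := by
  have key : ∀ n, Pn 0 (dstarFun Dp Dm Pn φ n) =
      -(starFun (posPart Pn) (dstarFun Dp Dm Pn φ) n) := by
    intro n
    have h1 : starFun (posPart Pn) (dstarFun Dp Dm Pn φ) n =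
        starFun (posPart Pn) (starFun (dGreen Dp Pn) φ) n
          - starFun (posPart Pn) (starFun (dGreen Dm Pn) φ) n := by
      rw [starFun, starFun, starFun, ← Finset.sum_sub_distrib]
      refine Finset.sum_congr rfl fun p _ => ?_
      rw [← map_sub]
      rfl
    rw [h1, dstarFun, Pi.sub_apply, map_sub, P_starFun_dGreen A Pn hPpos Dp hPDp φ hφ,
      P_starFun_dGreen A Pn hPpos Dm hPDm φ hφ]
    abel
  refine ⟨funext key, fun n => ?_, ?_⟩
  · rw [key]
    exact A.neg_mem (starFun_posPart_mem A Pn hPpos _ n)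
  · funext n
    rw [key]
    simp [tMap]
    abel

end NCQFT
end
end

section
/- The adjoint of the inverse solution-space isomorphism is given explicitly: for T_±^{-1} := id_{B[[λ]]} − Δ_⋆± ∘ Q with Q := Σ_{n≥1} λⁿ P_(n), one has β(T_±^{-1}(u), ψ) = β(u, ψ − Q(Δ_⋆∓(ψ))) for all u ∈ B[[λ]] and ψ ∈ A[[λ]]; i.e. the β-adjoint of T_±^{-1} on A[[λ]] is id − Q ∘ Δ_⋆∓. -/
open Finset

noncomputable section

namespace NCQFT

/-- The `ℝ[[λ]]`-bilinear extension of a bilinear form `β : B × B → ℝ` to `B[[λ]]`. -/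
def betaSeries {B : Type*} [AddCommGroup B] [Module ℝ B]
    (β : B →ₗ[ℝ] B →ₗ[ℝ] ℝ) (u v : ℕ → B) : PowerSeries ℝ :=
  PowerSeries.mk fun n => ∑ p ∈ antidiagonal n, β (u p.1) (v p.2)

theorem chain_append_singleton {B : Type*} [AddCommGroup B] [Module ℝ B]
    (D : B →ₗ[ℝ] B) (Pn : ℕ → B →ₗ[ℝ] B) (l : List ℕ) (j : ℕ) :
    chain D Pn (l ++ [j]) = chain D Pn l ∘ₗ Pn j ∘ₗ D := by
  induction l with
  | nil => rfl
  | cons i t ih =>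
    rw [List.cons_append, chain, ih, chain]
    rfl

theorem chain_adjoint {B : Type*} [AddCommGroup B] [Module ℝ B] (A : Submodule ℝ B)
    (Pn : ℕ → B →ₗ[ℝ] B) (hPpos : ∀ n, 0 < n → ∀ u : B, Pn n u ∈ A)
    (D D' : B →ₗ[ℝ] B) (β : B →ₗ[ℝ] B →ₗ[ℝ] ℝ)
    (hβP : ∀ (n : ℕ) (u v : B), β (Pn n u) v = β u (Pn n v))
    (hD : ∀ a ∈ A, ∀ b ∈ A, β (D a) b = β a (D' b))
    (l : List ℕ) (hl : ∀ j ∈ l, 0 < j) (a : B) (ha : a ∈ A) :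
    ∀ b ∈ A, β (chain D Pn l a) b = β a (chain D' Pn l.reverse b) := by
  induction l with
  | nil => exact fun b hb => hD a ha b hb
  | cons j t ih =>
    intro b hb
    have hj : 0 < j := hl j (by simp)
    rw [List.reverse_cons, chain_append_singleton, chain]
    simp only [LinearMap.comp_apply]
    rw [hD _ (hPpos j hj _) b hb, hβP]
    exact ih (fun i hi => hl i (by simp [hi])) _ (hPpos j hj _)

theorem dGreen_adjoint {B : Type*} [AddCommGroup B] [Module ℝ B] (A : Submodule ℝ B)
    (Pn : ℕ → B →ₗ[ℝ] B) (hPpos : ∀ n, 0 < n → ∀ u : B, Pn n u ∈ A)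
    (D D' : B →ₗ[ℝ] B) (β : B →ₗ[ℝ] B →ₗ[ℝ] ℝ)
    (hβP : ∀ (n : ℕ) (u v : B), β (Pn n u) v = β u (Pn n v))
    (hD : ∀ a ∈ A, ∀ b ∈ A, β (D a) b = β a (D' b))
    (n : ℕ) (a : B) (ha : a ∈ A) (b : B) (hb : b ∈ A) :
    β (dGreen D Pn n a) b = β a (dGreen D' Pn n b) := by
  unfold dGreen
  simp only [LinearMap.sum_apply, map_sum, LinearMap.smul_apply, map_smul]
  let r : Composition n → Composition n := fun c =>
    ⟨c.blocks.reverse, fun hi => c.blocks_pos (List.mem_reverse.1 hi),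
      by rw [List.sum_reverse, c.blocks_sum]⟩
  have hr : ∀ c, r (r c) = c := fun c => Composition.ext (List.reverse_reverse _)
  refine Finset.sum_bij' (fun c _ => r c) (fun c _ => r c) (by simp) (by simp)
    (fun c _ => hr c) (fun c _ => hr c) ?_
  intro c _
  rw [chain_adjoint A Pn hPpos D D' β hβP hD c.blocks (fun j hj => c.blocks_pos hj) a ha b hb]
  simp [r]

theorem betaSeries_starFun {B : Type*} [AddCommGroup B] [Module ℝ B]
    (β : B →ₗ[ℝ] B →ₗ[ℝ] ℝ) (F G : ℕ → B →ₗ[ℝ] B) (u v : ℕ → B)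
    (h : ∀ m i j, β (F m (u i)) (v j) = β (u i) (G m (v j))) :
    betaSeries β (starFun F u) v = betaSeries β u (starFun G v) := by
  unfold betaSeries starFun
  congr 1
  funext n
  simp only [LinearMap.sum_apply, map_sum, h]
  rw [Finset.sum_sigma', Finset.sum_sigma']
  refine Finset.sum_bij' (fun x _ => ⟨(x.2.2, x.2.1 + x.1.2), (x.2.1, x.1.2)⟩)
    (fun x _ => ⟨(x.2.1 + x.1.1, x.2.2), (x.2.1, x.1.1)⟩) ?_ ?_ ?_ ?_ ?_ <;>
  rintro ⟨⟨a, b⟩, ⟨c, d⟩⟩ hx <;>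
  simp only [Finset.mem_sigma, Finset.HasAntidiagonal.mem_antidiagonal] at hx ⊢
  · exact ⟨by omega, trivial⟩
  · exact ⟨by omega, trivial⟩
  · obtain ⟨h1, h2⟩ := hx
    subst h2
    rfl
  · obtain ⟨h1, h2⟩ := hx
    subst h2
    rfl

theorem betaSeries_sub_left {B : Type*} [AddCommGroup B] [Module ℝ B]
    (β : B →ₗ[ℝ] B →ₗ[ℝ] ℝ) (u w v : ℕ → B) :
    betaSeries β (u - w) v = betaSeries β u v - betaSeries β w v := by
  ext n
  simp [betaSeries, Finset.sum_sub_distrib]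

theorem betaSeries_sub_right {B : Type*} [AddCommGroup B] [Module ℝ B]
    (β : B →ₗ[ℝ] B →ₗ[ℝ] ℝ) (u w v : ℕ → B) :
    betaSeries β v (u - w) = betaSeries β v u - betaSeries β v w := by
  ext n
  simp [betaSeries, Finset.sum_sub_distrib]

theorem main_adjoint {B : Type*} [AddCommGroup B] [Module ℝ B] (A : Submodule ℝ B)
    (Pn : ℕ → B →ₗ[ℝ] B) (hPpos : ∀ n, 0 < n → ∀ u : B, Pn n u ∈ A)
    (D D' : B →ₗ[ℝ] B)
    (hPD : ∀ a ∈ A, Pn 0 (D a) = a) (hPD' : ∀ a ∈ A, Pn 0 (D' a) = a)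
    (β : B →ₗ[ℝ] B →ₗ[ℝ] ℝ)
    (hβP : ∀ (n : ℕ) (u v : B), β (Pn n u) v = β u (Pn n v))
    (u : ℕ → B) (ψ : ℕ → B) (hψ : ∀ n, ψ n ∈ A) :
    betaSeries β (u - starFun (dGreen D Pn) (starFun (posPart Pn) u)) ψ
      = betaSeries β u (ψ - starFun (posPart Pn) (starFun (dGreen D' Pn) ψ)) := by
  have hD : ∀ a ∈ A, ∀ b ∈ A, β (D a) b = β a (D' b) := by
    intro a ha b hb
    conv_lhs => rw [← hPD' b hb]
    rw [← hβP, hPD a ha]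
  have hQ : ∀ n, starFun (posPart Pn) u n ∈ A := by
    intro n
    refine Submodule.sum_mem _ fun p _ => ?_
    unfold posPart
    split_ifs with h0
    · simp
    · exact hPpos _ (Nat.pos_of_ne_zero h0) _
  rw [betaSeries_sub_left, betaSeries_sub_right,
    betaSeries_starFun β (dGreen D Pn) (dGreen D' Pn) _ ψ
      (fun m i j => dGreen_adjoint A Pn hPpos D D' β hβP hD m _ (hQ i) _ (hψ j)),
    betaSeries_starFun β (posPart Pn) (posPart Pn) u]
  intro m i j
  unfold posPart
  split_ifs
  · simp
  · exact hβP _ _ _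

/-- the adjoint of the inverse solution-space isomorphism is given explicitly:
for `T_±⁻¹ := id − Δ_⋆± ∘ Q` with `Q := Σ_{n≥1} λⁿ P_(n)`, one has
`β(T_±⁻¹(u), ψ) = β(u, ψ − Q(Δ_⋆∓(ψ)))` for all `u ∈ B[[λ]]`, `ψ ∈ A[[λ]]`;
i.e. the `β`-adjoint of `T_±⁻¹` on `A[[λ]]` is `id − Q ∘ Δ_⋆∓`. -/
theorem statement_13
    {B : Type*} [AddCommGroup B] [Module ℝ B] (A : Submodule ℝ B)
    -- the family `P_(n)` (`P := P_(0)`), with `P(A) ⊆ A` and `P_(n) : B → A` for `n ≥ 1`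
    (Pn : ℕ → B →ₗ[ℝ] B)
    (hPA : ∀ a ∈ A, Pn 0 a ∈ A)
    (hPpos : ∀ n, 0 < n → ∀ u : B, Pn n u ∈ A)
    -- the undeformed retarded/advanced Green's operators `Δ_±` (defined on `A`)
    (Dp Dm : B →ₗ[ℝ] B)
    (hPDp : ∀ a ∈ A, Pn 0 (Dp a) = a) (hDpP : ∀ a ∈ A, Dp (Pn 0 a) = a)
    (hPDm : ∀ a ∈ A, Pn 0 (Dm a) = a) (hDmP : ∀ a ∈ A, Dm (Pn 0 a) = a)
    -- `β` is a symmetric bilinear form on `B`, each `P_(n)` formally self-adjoint for `β`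
    (β : B →ₗ[ℝ] B →ₗ[ℝ] ℝ)
    (hβsymm : ∀ u v : B, β u v = β v u)
    (hβP : ∀ (n : ℕ) (u v : B), β (Pn n u) v = β u (Pn n v))
    (u : ℕ → B) (ψ : ℕ → B) (hψ : ∀ n, ψ n ∈ A) :
    betaSeries β (u - starFun (dGreen Dp Pn) (starFun (posPart Pn) u)) ψ
      = betaSeries β u (ψ - starFun (posPart Pn) (starFun (dGreen Dm Pn) ψ)) ∧
    betaSeries β (u - starFun (dGreen Dm Pn) (starFun (posPart Pn) u)) ψ
      = betaSeries β u (ψ - starFun (posPart Pn) (starFun (dGreen Dp Pn) ψ)) := by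
  exact ⟨main_adjoint A Pn hPpos Dp Dm hPDp hPDm β hβP u ψ hψ,
    main_adjoint A Pn hPpos Dm Dp hPDm hPDp β hβP u ψ hψ⟩

end NCQFT
end
end
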